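/- Let 1 ≤ k ≤ n. The function σ_k(κ) := (H_k(κ))^{1/k} is concave on the cone Γ_k. -/

import Mathlib

noncomputable section

/-- The `k`-th elementary symmetric polynomial `H_k` of `κ ∈ ℝⁿ`. -/
def esymm (n k : ℕ) (κ : Fin n → ℝ) : ℝ :=
  ∑ s ∈ Finset.powersetCard k (Finset.univ : Finset (Fin n)), ∏ i ∈ s, κ i

/-- The positive cone `Γ₊ ⊆ ℝⁿ`. -/
def GammaPlus (n : ℕ) : Set (Fin n → ℝ) := {κ | ∀ i, 0 < κ i}

/-- The Garding cone `Γ_k = {κ : H_1(κ) > 0, …, H_k(κ) > 0}`. -/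
def GammaK (n k : ℕ) : Set (Fin n → ℝ) :=
  {κ | ∀ j : ℕ, 1 ≤ j → j ≤ k → 0 < esymm n j κ}

open Finset

/-- The derivative of a real-rooted polynomial is real-rooted. -/
theorem Polynomial.Splits.derivative_real {p : Polynomial ℝ} (hp : p.Splits) :
    (Polynomial.derivative p).Splits := by
  rw [Polynomial.splits_iff_card_roots] at hp ⊢
  have h₁ := p.card_roots_le_derivative
  have h₂ := Polynomial.card_roots' (Polynomial.derivative p)
  have h₃ := Polynomial.natDegree_derivative_le p
  rcases Nat.eq_zero_or_pos p.natDegree with h | h <;> omega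

theorem Multiset.two_mul_coeff_prod_X_sub_C_le (m : Multiset ℝ) :
    2 * (m.map fun a => Polynomial.X - Polynomial.C a).prod.coeff 0 *
        (m.map fun a => Polynomial.X - Polynomial.C a).prod.coeff 2 ≤
      (m.map fun a => Polynomial.X - Polynomial.C a).prod.coeff 1 ^ 2 := by
  induction m using Multiset.induction_on with
  | empty => simp [Polynomial.coeff_one]
  | cons a m ih =>
    rw [Multiset.map_cons, Multiset.prod_cons]
    set q := (m.map fun a => Polynomial.X - Polynomial.C a).prod
    have h₀ : ((Polynomial.X - Polynomial.C a) * q).coeff 0 = -(a * q.coeff 0) := by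
      simp [sub_mul]
    have h₁ : ((Polynomial.X - Polynomial.C a) * q).coeff 1 = q.coeff 0 - a * q.coeff 1 := by
      simp [sub_mul, Polynomial.coeff_X_mul q 0]
    have h₂ : ((Polynomial.X - Polynomial.C a) * q).coeff 2 = q.coeff 1 - a * q.coeff 2 := by
      simp [sub_mul, Polynomial.coeff_X_mul q 1]
    rw [h₀, h₁, h₂]
    nlinarith [sq_nonneg (q.coeff 0), mul_nonneg (sq_nonneg a) (sub_nonneg.2 ih)]

/-- A form of Newton's inequalities for the coefficients of a real-rooted polynomial. -/
theorem Polynomial.Splits.newton_coeff (m : ℕ) {p : Polynomial ℝ} (hp : p.Splits) :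
    (m + 2) * (p.coeff m * p.coeff (m + 2)) ≤ (m + 1) * p.coeff (m + 1) ^ 2 := by
  induction m generalizing p with
  | zero =>
    have h := mul_le_mul_of_nonneg_left p.roots.two_mul_coeff_prod_X_sub_C_le
      (sq_nonneg p.leadingCoeff)
    have h' (i : ℕ) : p.coeff i = p.leadingCoeff *
        (p.roots.map fun a => Polynomial.X - Polynomial.C a).prod.coeff i := by
      conv_lhs => rw [hp.eq_prod_roots, Polynomial.coeff_C_mul]
    rw [h' 0, h' (0 + 1), h' (0 + 2)]
    norm_num
    linarith
  | succ m ih =>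
    have h := ih hp.derivative_real
    simp only [Polynomial.coeff_derivative] at h
    push_cast at h ⊢
    have hm : (0 : ℝ) < (m + 1) * (m + 2) := by positivity
    refine le_of_mul_le_mul_left ?_ hm
    rw [show m + 1 + 2 = m + 2 + 1 by omega]
    linarith

/-- The elementary symmetric function of degree `k` in the variables indexed by `s`. -/
def Finset.esymmOn {ι : Type*} (s : Finset ι) (k : ℕ) (x : ι → ℝ) : ℝ :=
  ∑ t ∈ s.powersetCard k, ∏ i ∈ t, x i

namespace Finset

variable {ι : Type*} {s : Finset ι} {i : ι} {x y : ι → ℝ} {k : ℕ}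

@[simp] theorem esymmOn_zero : s.esymmOn 0 x = 1 := by simp [esymmOn]

theorem esymmOn_one : s.esymmOn 1 x = ∑ i ∈ s, x i := by
  simp [esymmOn, powersetCard_one]

theorem esymmOn_eq_zero (h : #s < k) : s.esymmOn k x = 0 := by
  simp [esymmOn, powersetCard_eq_empty.2 h]

/-- A weak form of Newton's inequality. -/
theorem esymmOn_mul_le_sq (s : Finset ι) (k : ℕ) (x : ι → ℝ) :
    s.esymmOn k x * s.esymmOn (k + 2) x ≤ s.esymmOn (k + 1) x ^ 2 := by
  rcases lt_or_ge #s (k + 2) with h | h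
  · rw [esymmOn_eq_zero h, mul_zero]
    exact sq_nonneg _
  · obtain ⟨m, hm⟩ := Nat.exists_eq_add_of_le h
    have hp : (∏ i ∈ s, (Polynomial.X + Polynomial.C (x i))).Splits :=
      Polynomial.Splits.prod fun i _ => Polynomial.Splits.X_add_C (x i)
    have hN := hp.newton_coeff m
    rw [prod_X_add_C_coeff s x (by omega), prod_X_add_C_coeff s x (by omega),
      prod_X_add_C_coeff s x (by omega), show #s - m = k + 2 by omega,
      show #s - (m + 2) = k by omega, show #s - (m + 1) = k + 1 by omega] at hN
    change (m + 2) * (s.esymmOn (k + 2) x * s.esymmOn k x) ≤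
      (m + 1) * s.esymmOn (k + 1) x ^ 2 at hN
    have hm : (0 : ℝ) < m + 2 := by positivity
    refine le_of_mul_le_mul_left ?_ hm
    nlinarith [sq_nonneg (s.esymmOn (k + 1) x)]

/-- The Gårding cone for the variables indexed by `s`. -/
def gardingCone (s : Finset ι) (k : ℕ) : Set (ι → ℝ) :=
  {x | ∀ j ≤ k, 0 < s.esymmOn j x}

theorem mem_gardingCone_succ :
    x ∈ s.gardingCone (k + 1) ↔ x ∈ s.gardingCone k ∧ 0 < s.esymmOn (k + 1) x := by
  refine ⟨fun h => ⟨fun j hj => h j (by omega), h _ le_rfl⟩, fun h j hj => ?_⟩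
  rcases Nat.le_succ_iff.1 hj with hj | rfl
  exacts [h.1 j hj, h.2]

theorem gardingCone_anti {j : ℕ} (h : j ≤ k) : s.gardingCone k ⊆ s.gardingCone j :=
  fun _ hx i hi => hx i (hi.trans h)

/-- The quotient of consecutive elementary symmetric functions. -/
def esymmQuot (s : Finset ι) (k : ℕ) (x : ι → ℝ) : ℝ :=
  s.esymmOn (k + 1) x / s.esymmOn k x

theorem gardingCone_succ_eq :
    s.gardingCone (k + 1) = {x ∈ s.gardingCone k | 0 < s.esymmQuot k x} := by
  ext x
  rw [mem_gardingCone_succ, Set.mem_ofPred_eq]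
  refine and_congr_right fun h => ?_
  rw [esymmQuot, div_pos_iff_of_pos_right (h k le_rfl)]

theorem prod_esymmQuot (hx : x ∈ s.gardingCone k) :
    ∏ j ∈ range k, s.esymmQuot j x = s.esymmOn k x := by
  induction k with
  | zero => simp
  | succ k ih =>
    have hx' := (mem_gardingCone_succ.1 hx).1
    rw [prod_range_succ, ih hx', esymmQuot, mul_div_cancel₀ _ (hx' k le_rfl).ne']

variable [DecidableEq ι]

theorem esymmOn_insert (h : i ∉ s) : (insert i s).esymmOn (k + 1) x =
    x i * s.esymmOn k x + s.esymmOn (k + 1) x := by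
  have h' : ∀ t ∈ s.powersetCard k, i ∉ t := fun t ht hi => h ((mem_powersetCard.1 ht).1 hi)
  rw [esymmOn, powersetCard_succ_insert h, sum_union, sum_image, add_comm, esymmOn, mul_sum,
    esymmOn]
  · congr 1
    exact sum_congr rfl fun t ht => prod_insert (h' t ht)
  · intro t ht u hu htu
    rw [← erase_insert (h' t ht), ← erase_insert (h' u hu), htu]
  · rw [disjoint_left]
    intro t ht ht'
    obtain ⟨u, -, rfl⟩ := mem_image.1 ht'
    exact h ((mem_powersetCard.1 ht).1 (mem_insert_self i u))

theorem esymmOn_succ (h : i ∈ s) : s.esymmOn (k + 1) x =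
    x i * (s.erase i).esymmOn k x + (s.erase i).esymmOn (k + 1) x := by
  conv_lhs => rw [← insert_erase h]
  exact esymmOn_insert (notMem_erase i s)

/-- Euler's identity for elementary symmetric functions. -/
theorem sum_mul_esymmOn_erase (s : Finset ι) (k : ℕ) (x : ι → ℝ) :
    ∑ i ∈ s, x i * (s.erase i).esymmOn k x = (k + 1) * s.esymmOn (k + 1) x := by
  induction s using Finset.induction_on generalizing k with
  | empty => rw [sum_empty, esymmOn_eq_zero (by simp), mul_zero]
  | insert a s ha ih =>
    rw [sum_insert ha, erase_insert ha, esymmOn_insert ha]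
    cases k with
    | zero => simp [esymmOn_one]
    | succ k =>
      have h : ∀ i ∈ s, x i * ((insert a s).erase i).esymmOn (k + 1) x =
          x a * (x i * (s.erase i).esymmOn k x) + x i * (s.erase i).esymmOn (k + 1) x := by
        intro i hi
        rw [erase_insert_of_ne (by rintro rfl; exact ha hi),
          esymmOn_insert (fun h => ha (mem_of_mem_erase h))]
        ring
      rw [sum_congr rfl h, sum_add_distrib, ← mul_sum, ih, ih]
      push_cast
      ring

theorem add_two_mul_esymmOn (s : Finset ι) (k : ℕ) (x : ι → ℝ) :
    (k + 2) * s.esymmOn (k + 2) x = s.esymmOn 1 x * s.esymmOn (k + 1) x -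
      ∑ i ∈ s, x i ^ 2 * (s.erase i).esymmOn k x := by
  have h := sum_mul_esymmOn_erase s (k + 1) x
  have h' : ∀ i ∈ s, x i * (s.erase i).esymmOn (k + 1) x =
      x i * s.esymmOn (k + 1) x - x i ^ 2 * (s.erase i).esymmOn k x := by
    intro i hi
    rw [esymmOn_succ hi]
    ring
  rw [sum_congr rfl h', sum_sub_distrib, ← sum_mul, ← esymmOn_one] at h
  push_cast at h
  linarith

theorem mem_gardingCone_erase (hi : i ∈ s) (hx : x ∈ s.gardingCone (k + 1)) :
    x ∈ (s.erase i).gardingCone k := by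
  induction k with
  | zero =>
    intro j hj
    rw [Nat.le_zero.1 hj]
    simp
  | succ k ih =>
    have hx' := mem_gardingCone_succ.1 hx
    refine mem_gardingCone_succ.2 ⟨ih hx'.1, ?_⟩
    by_contra! hneg
    have h₀ := ih hx'.1 k le_rfl
    have h₁ := hx'.1 (k + 1) le_rfl
    have h₂ := hx'.2
    rw [esymmOn_succ hi] at h₁ h₂
    have hN := esymmOn_mul_le_sq (s.erase i) k x
    have hxi : 0 < x i := by
      by_contra! hle
      nlinarith
    nlinarith [mul_pos h₀ h₂, mul_nonneg_of_nonpos_of_nonpos hneg (neg_nonpos.2 h₁.le)]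

theorem add_esymmQuot_erase (hi : i ∈ s) (hx : x ∈ s.gardingCone (k + 1)) :
    x i + (s.erase i).esymmQuot k x = s.esymmOn (k + 1) x / (s.erase i).esymmOn k x := by
  have h := (mem_gardingCone_erase hi hx k le_rfl).ne'
  rw [esymmQuot, esymmOn_succ hi]
  field_simp

theorem add_esymmQuot_erase_pos (hi : i ∈ s) (hx : x ∈ s.gardingCone (k + 1)) :
    0 < x i + (s.erase i).esymmQuot k x := by
  rw [add_esymmQuot_erase hi hx]
  exact div_pos (hx _ le_rfl) (mem_gardingCone_erase hi hx k le_rfl)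

theorem esymmQuot_succ (hx : x ∈ s.gardingCone (k + 1)) :
    s.esymmQuot (k + 1) x = ((k : ℝ) + 2)⁻¹ *
      (∑ i ∈ s, x i - ∑ i ∈ s, x i ^ 2 / (x i + (s.erase i).esymmQuot k x)) := by
  have h : ∀ i ∈ s, x i ^ 2 / (x i + (s.erase i).esymmQuot k x) =
      x i ^ 2 * (s.erase i).esymmOn k x / s.esymmOn (k + 1) x := by
    intro i hi
    rw [add_esymmQuot_erase hi hx, div_div_eq_mul_div]
  have hpos := (hx (k + 1) le_rfl).ne'
  have hk : (k : ℝ) + 2 ≠ 0 := by positivity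
  rw [sum_congr rfl h, ← sum_div, ← esymmOn_one, esymmQuot]
  field_simp
  linarith [add_two_mul_esymmOn s k x]

end Finset

theorem ConcaveOn.convexOn_sq_div {E : Type*} [AddCommGroup E] [Module ℝ E] {S : Set E}
    {f : E →ₗ[ℝ] ℝ} {g : E → ℝ} (hg : ConcaveOn ℝ S g) (hpos : ∀ x ∈ S, 0 < g x) :
    ConvexOn ℝ S fun x => f x ^ 2 / g x := by
  refine ⟨hg.1, fun x hx y hy a b ha hb hab => ?_⟩
  have hgx := hpos x hx
  have hgy := hpos y hy
  have hc := hg.2 hx hy ha hb hab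
  simp only [smul_eq_mul, map_add, map_smul] at hc ⊢
  have hu : 0 < a * g x + b * g y := by
    rcases ha.eq_or_lt with rfl | ha
    · simp_all
    · positivity
  refine (div_le_div_of_nonneg_left (sq_nonneg _) hu hc).trans ?_
  rw [div_le_iff₀ hu, ← sub_nonneg]
  have : (a * (f x ^ 2 / g x) + b * (f y ^ 2 / g y)) * (a * g x + b * g y) -
      (a * f x + b * f y) ^ 2 = a * b * (f x * g y - f y * g x) ^ 2 / (g x * g y) := by
    field_simp
    ring
  rw [this]
  positivity

theorem ConcaveOn.finset_prod_rpow {E κ : Type*} [AddCommGroup E] [Module ℝ E] {S : Set E}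
    {t : Finset κ} (ht : t.Nonempty) {f : κ → E → ℝ} (hf : ∀ j ∈ t, ConcaveOn ℝ S (f j))
    (hpos : ∀ j ∈ t, ∀ x ∈ S, 0 < f j x) :
    ConcaveOn ℝ S fun x => (∏ j ∈ t, f j x) ^ (1 / (#t : ℝ)) := by
  obtain ⟨j₀, hj₀⟩ := ht
  refine ⟨(hf j₀ hj₀).1, fun x hx y hy a b ha hb hab => ?_⟩
  have hz := (hf j₀ hj₀).1 hx hy ha hb hab
  set z := a • x + b • y
  have hcard : (#t : ℝ) ≠ 0 := by exact_mod_cast (card_pos.2 ⟨j₀, hj₀⟩).ne'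
  have amgm (u : E) (hu : u ∈ S) : (∏ j ∈ t, f j u) ^ (1 / (#t : ℝ)) ≤
      (∏ j ∈ t, f j z) ^ (1 / (#t : ℝ)) * ∑ j ∈ t, 1 / (#t : ℝ) * (f j u / f j z) := by
    have h := Real.geom_mean_le_arith_mean_weighted t (fun _ => 1 / (#t : ℝ))
      (fun j => f j u / f j z) (fun _ _ => by positivity)
      (by simp [hcard]) (fun j hj => (div_pos (hpos j hj u hu) (hpos j hj z hz)).le)
    rw [Real.finsetProd_rpow _ _
      (fun j hj => (div_pos (hpos j hj u hu) (hpos j hj z hz)).le), prod_div_distrib,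
      Real.div_rpow (prod_nonneg fun j hj => (hpos j hj u hu).le)
        (prod_nonneg fun j hj => (hpos j hj z hz).le),
      div_le_iff₀ (Real.rpow_pos_of_pos (prod_pos fun j hj => hpos j hj z hz) _)] at h
    linarith
  simp only [smul_eq_mul]
  calc a * (∏ j ∈ t, f j x) ^ (1 / (#t : ℝ)) + b * (∏ j ∈ t, f j y) ^ (1 / (#t : ℝ))
      ≤ a * ((∏ j ∈ t, f j z) ^ (1 / (#t : ℝ)) * ∑ j ∈ t, 1 / (#t : ℝ) * (f j x / f j z)) +
        b * ((∏ j ∈ t, f j z) ^ (1 / (#t : ℝ)) * ∑ j ∈ t, 1 / (#t : ℝ) * (f j y / f j z)) := by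
        gcongr
        exacts [amgm x hx, amgm y hy]
    _ = (∏ j ∈ t, f j z) ^ (1 / (#t : ℝ)) *
        ∑ j ∈ t, 1 / (#t : ℝ) * ((a * f j x + b * f j y) / f j z) := by
        simp only [add_div, mul_add, sum_add_distrib, mul_sum]
        congr 1 <;> exact sum_congr rfl fun j _ => by ring
    _ ≤ (∏ j ∈ t, f j z) ^ (1 / (#t : ℝ)) * ∑ j ∈ t, 1 / (#t : ℝ) * 1 := by
        refine mul_le_mul_of_nonneg_left (sum_le_sum fun j hj => ?_)
          (Real.rpow_nonneg (prod_nonneg fun j hj => (hpos j hj z hz).le) _)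
        refine mul_le_mul_of_nonneg_left ?_ (by positivity)
        rw [div_le_one (hpos j hj z hz)]
        exact (hf j hj).2 hx hy ha hb hab
    _ = (∏ j ∈ t, f j z) ^ (1 / (#t : ℝ)) := by simp [hcard]

namespace Finset

variable {ι : Type*} [DecidableEq ι]

theorem concaveOn_esymmQuot (s : Finset ι) (k : ℕ) :
    ConcaveOn ℝ (s.gardingCone k) (s.esymmQuot k) := by
  induction k generalizing s with
  | zero =>
    have h : s.gardingCone 0 = Set.univ :=
      Set.eq_univ_of_forall fun x j hj => by rw [Nat.le_zero.1 hj]; simp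
    have h' : s.esymmQuot 0 = ∑ i ∈ s, LinearMap.proj (R := ℝ) (φ := fun _ : ι => ℝ) i := by
      ext x
      simp [esymmQuot, esymmOn_one]
    rw [h, h']
    exact LinearMap.concaveOn _ convex_univ
  | succ k ih =>
    have hconv : Convex ℝ (s.gardingCone (k + 1)) := by
      rw [gardingCone_succ_eq]
      exact (ih s).convex_gt 0
    have hsum : ConvexOn ℝ (s.gardingCone (k + 1))
        (fun x => ∑ i ∈ s, x i ^ 2 / (x i + (s.erase i).esymmQuot k x)) := by
      have h : ∀ i ∈ s, ConvexOn ℝ (s.gardingCone (k + 1))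
          (fun x => x i ^ 2 / (x i + (s.erase i).esymmQuot k x)) := by
        intro i hi
        refine ConcaveOn.convexOn_sq_div (f := LinearMap.proj (R := ℝ) (φ := fun _ : ι => ℝ) i)
          (((LinearMap.proj (R := ℝ) (φ := fun _ : ι => ℝ) i).concaveOn hconv).add
            ((ih (s.erase i)).subset (fun x hx => mem_gardingCone_erase hi hx) hconv))
          fun x hx => add_esymmQuot_erase_pos hi hx
      refine ⟨hconv, fun x hx y hy a b ha hb hab => ?_⟩
      simp only [smul_eq_mul, mul_sum, ← sum_add_distrib]
      exact sum_le_sum fun i hi => (h i hi).2 hx hy ha hb hab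
    have hlin : ConcaveOn ℝ (s.gardingCone (k + 1)) (fun x => ∑ i ∈ s, x i) := by
      have h := (∑ i ∈ s, LinearMap.proj (R := ℝ) (φ := fun _ : ι => ℝ) i).concaveOn hconv
      refine h.congr fun x _ => ?_
      simp
    have hk : (0 : ℝ) ≤ ((k : ℝ) + 2)⁻¹ := by positivity
    exact ((hlin.sub hsum).smul hk).congr fun x hx => (esymmQuot_succ hx).symm

theorem concaveOn_esymmOn_rpow (s : Finset ι) {k : ℕ} (hk : k ≠ 0) :
    ConcaveOn ℝ (s.gardingCone k) (fun x => s.esymmOn k x ^ (1 / (k : ℝ))) := by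
  obtain ⟨m, rfl⟩ := Nat.exists_eq_succ_of_ne_zero hk
  have hconv : Convex ℝ (s.gardingCone (m + 1)) := by
    rw [gardingCone_succ_eq]
    exact (concaveOn_esymmQuot s m).convex_gt 0
  have h := ConcaveOn.finset_prod_rpow (S := s.gardingCone (m + 1))
    (nonempty_range_iff.2 hk) (f := s.esymmQuot)
    (fun j hj => (concaveOn_esymmQuot s j).subset
      (gardingCone_anti (mem_range.1 hj).le) hconv)
    (fun j hj x hx => div_pos (hx _ (mem_range.1 hj)) (hx _ (mem_range.1 hj).le))
  refine h.congr fun x hx => ?_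
  simp only [prod_esymmQuot hx, card_range]

end Finset

/-- the `k`-th root `σ_k = H_k^{1/k}` is concave on `Γ_k`. -/
theorem esymm_root_concave (n k : ℕ) (hk1 : 1 ≤ k) (hkn : k ≤ n) :
    ConcaveOn ℝ (GammaK n k) (fun κ => esymm n k κ ^ (1 / (k : ℝ))) := by
  have h : GammaK n k = (univ : Finset (Fin n)).gardingCone k := by
    ext x
    refine ⟨fun hx j hj => ?_, fun hx j _ hj => hx j hj⟩
    rcases Nat.eq_zero_or_pos j with rfl | h0
    · simp
    · exact hx j h0 hj
  rw [h]
  exact concaveOn_esymmOn_rpow univ (by omega)
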